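/- A proper branched minimal immersion of the disk into the Euclidean unit ball Bⁿ meeting ∂Bⁿ orthogonally has image equal to an equatorial totally geodesic disk (the intersection of Bⁿ with a 2-plane through the origin). -/

import Mathlib

open Metric

/-- The Wirtinger derivative `∂_z u = (u_x - i u_y)/2`. -/
noncomputable def wdz {E : Type*} [NormedAddCommGroup E] [NormedSpace ℂ E]
    (u : ℂ → E) (z : ℂ) : E :=
  (1 / 2 : ℂ) • (fderiv ℝ u z 1 - Complex.I • fderiv ℝ u z Complex.I)

/-- The Wirtinger derivative `∂_z̄ u = (u_x + i u_y)/2`. -/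
noncomputable def wdzbar {E : Type*} [NormedAddCommGroup E] [NormedSpace ℂ E]
    (u : ℂ → E) (z : ℂ) : E :=
  (1 / 2 : ℂ) • (fderiv ℝ u z 1 + Complex.I • fderiv ℝ u z Complex.I)

/-- Complexification of an `ℝⁿ`-valued map. -/
def cplx {n : ℕ} (u : ℂ → (Fin n → ℝ)) : ℂ → (Fin n → ℂ) :=
  fun z i => ((u z i : ℝ) : ℂ)

/-- At a boundary point write `h = l x - i y` for the Hopf vector `z u_z` and `m x + l y - i w` for
its angular derivative. If the square of the latter has vanishing real part, then the two vectors
are proportional. -/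
lemma cross_eq_of_sum_sq_eq {ι : Type*} [Fintype ι] {x y w : ι → ℝ} {l m : ℝ}
    (hxx : ∑ i, x i ^ 2 = 1) (hxy : ∑ i, x i * y i = 0)
    (hxw : ∑ i, x i * w i = -l ^ 2) (hyy : ∑ i, y i ^ 2 = l ^ 2)
    (hyw : ∑ i, y i * w i = l * m)
    (hww : ∑ i, (m * x i + l * y i) ^ 2 = ∑ i, w i ^ 2) (i j : ι) :
    (⟨m * x i + l * y i, -w i⟩ : ℂ) * ⟨l * x j, -y j⟩ =
      (⟨m * x j + l * y j, -w j⟩ : ℂ) * ⟨l * x i, -y i⟩ := by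
  by_cases hl : l = 0
  · have hy : ∀ i, y i = 0 := by
      have h0 : ∑ i, y i ^ 2 = 0 := by rw [hyy, hl]; ring
      intro i
      have := (Finset.sum_eq_zero_iff_of_nonneg (fun i _ => sq_nonneg (y i))).1 h0 i
        (Finset.mem_univ i)
      simpa using this
    apply Complex.ext <;> simp [hl, hy]
  · have hww' : ∑ i, w i ^ 2 = m ^ 2 + l ^ 4 := by
      rw [← hww]
      have : ∀ i, (m * x i + l * y i) ^ 2 =
        m ^ 2 * x i ^ 2 + 2 * m * l * (x i * y i) + l ^ 2 * y i ^ 2 := fun i => by ring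
      simp only [this, Finset.sum_add_distrib, ← Finset.mul_sum, hxx, hxy, hyy]
      ring
    have h0 : ∑ i, (l * w i + l ^ 3 * x i - m * y i) ^ 2 = 0 := by
      have : ∀ i, (l * w i + l ^ 3 * x i - m * y i) ^ 2 =
        l ^ 2 * w i ^ 2 + l ^ 6 * x i ^ 2 + m ^ 2 * y i ^ 2 + 2 * l ^ 4 * (x i * w i)
          - 2 * l * m * (y i * w i) - 2 * l ^ 3 * m * (x i * y i) := fun i => by ring
      simp only [this, Finset.sum_add_distrib, Finset.sum_sub_distrib, ← Finset.mul_sum,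
        hxx, hxy, hyy, hxw, hyw, hww']
      ring
    have hw : ∀ i, w i = m / l * y i - l ^ 2 * x i := by
      intro i
      have := (Finset.sum_eq_zero_iff_of_nonneg
        (fun i _ => sq_nonneg (l * w i + l ^ 3 * x i - m * y i))).1 h0 i (Finset.mem_univ i)
      have := pow_eq_zero_iff (two_ne_zero) |>.1 this
      field_simp
      linarith
    apply Complex.ext
    · simp [hw]; field_simp; ring
    · simp [hw]; field_simp; ring

/-- Along a curve on which the position `X` is a unit vector, `X` has derivative `-Im H`, `H` is isotropic and
`Re H` is a multiple of `X`, the derivative of `H` has real square and is proportional to `H` wherever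
that square vanishes. -/
lemma curve_hopf {ι : Type*} [Fintype ι] {X : ι → ℝ → ℝ} {H H' : ι → ℝ → ℂ}
    (hX : ∀ i t, HasDerivAt (X i) (-(H i t).im) t) (hH : ∀ i t, HasDerivAt (H i) (H' i t) t)
    (hXX : ∀ t, ∑ i, X i t ^ 2 = 1) (hHH : ∀ t, ∑ i, H i t ^ 2 = 0)
    (hfree : ∀ t, ∃ l : ℝ, ∀ i, (H i t).re = l * X i t) (t : ℝ) :
    (∑ i, H' i t ^ 2).im = 0 ∧
      (∑ i, H' i t ^ 2 = 0 → ∀ i j, H' i t * H j t = H' j t * H i t) := by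
  have hre : ∀ i t, HasDerivAt (fun s => (H i s).re) (H' i t).re t := fun i t =>
    Complex.reCLM.hasFDerivAt.comp_hasDerivAt t (hH i t)
  have him : ∀ i t, HasDerivAt (fun s => (H i s).im) (H' i t).im t := fun i t =>
    Complex.imCLM.hasFDerivAt.comp_hasDerivAt t (hH i t)
  set L : ℝ → ℝ := fun s => ∑ i, (H i s).re * X i s with hL
  have hHL : ∀ s i, (H i s).re = L s * X i s := by
    intro s i
    obtain ⟨l, hl⟩ := hfree s
    have : L s = l := by
      simp only [hL, hl, mul_assoc, ← pow_two, ← Finset.mul_sum, hXX, mul_one]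
    rw [this, hl]
  obtain ⟨m, hm⟩ : ∃ m, HasDerivAt L m t :=
    ⟨_, HasDerivAt.fun_sum fun i _ => (hre i t).mul (hX i t)⟩
  have hxy : ∀ s, ∑ i, X i s * (H i s).im = 0 := by
    intro s
    have h1 : HasDerivAt (fun s => ∑ i, X i s ^ 2) (∑ i, _) s :=
      HasDerivAt.fun_sum fun i _ => (hX i s).pow 2
    simp only [hXX] at h1
    have h2 := h1.unique (hasDerivAt_const s (1:ℝ))
    have h3 : -(2:ℝ) * ∑ i, X i s * (H i s).im = 0 := by
      rw [← h2, Finset.mul_sum]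
      refine Finset.sum_congr rfl fun i _ => ?_
      simp; ring
    linarith
  have hyy : ∀ s, ∑ i, (H i s).im ^ 2 = L s ^ 2 := by
    intro s
    have h1 := congrArg Complex.re (hHH s)
    simp only [Complex.re_sum, pow_two, Complex.mul_re, hHL, Complex.zero_re] at h1
    have : ∀ i, L s * X i s * (L s * X i s) - (H i s).im * (H i s).im =
      L s ^ 2 * X i s ^ 2 - (H i s).im ^ 2 := fun i => by ring
    simp only [this, Finset.sum_sub_distrib, ← Finset.mul_sum, hXX] at h1
    linarith
  have hxw : ∑ i, X i t * (H' i t).im = L t ^ 2 := by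
    have h1 : HasDerivAt (fun s => ∑ i, X i s * (H i s).im) (∑ i, _) t :=
      HasDerivAt.fun_sum fun i _ => (hX i t).mul (him i t)
    simp only [hxy] at h1
    have h2 := h1.unique (hasDerivAt_const t (0:ℝ))
    rw [Finset.sum_add_distrib] at h2
    rw [← hyy]
    have : ∑ i, -(H i t).im * (H i t).im = - ∑ i, (H i t).im ^ 2 := by
      rw [← Finset.sum_neg_distrib]
      exact Finset.sum_congr rfl fun i _ => by ring
    linarith
  have hyw : ∑ i, (H i t).im * (H' i t).im = L t * m := by
    have h1 : HasDerivAt (fun s => ∑ i, (H i s).im ^ 2) (∑ i, _) t :=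
      HasDerivAt.fun_sum fun i _ => (him i t).pow 2
    simp only [hyy] at h1
    have h2 := h1.unique (hm.pow 2)
    have h3 : (2:ℝ) * ∑ i, (H i t).im * (H' i t).im = 2 * (L t * m) := by
      rw [show 2 * (L t * m) = _ by
        simpa [mul_assoc] using h2.symm, Finset.mul_sum]
    linarith
  have hH're : ∀ i, (H' i t).re = m * X i t - L t * (H i t).im := by
    intro i
    have h1 := hre i t
    simp only [hHL] at h1
    rw [h1.unique (hm.mul (hX i t))]
    ring
  refine ⟨?_, fun h0 i j => ?_⟩
  · have : ∀ i, (H' i t ^ 2).im = 2 * m * (X i t * (H' i t).im) -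
        2 * L t * ((H i t).im * (H' i t).im) := fun i => by
      rw [pow_two, Complex.mul_im, hH're]; ring
    simp only [Complex.im_sum, this, Finset.sum_sub_distrib, ← Finset.mul_sum, hxw, hyw]
    ring
  · have hww := congrArg Complex.re h0
    have : ∀ i, (H' i t ^ 2).re = (m * X i t + L t * -(H i t).im) ^ 2 - (-(H' i t).im) ^ 2 :=
      fun i => by rw [pow_two, Complex.mul_re, hH're]; ring
    simp only [Complex.re_sum, this, Finset.sum_sub_distrib, Complex.zero_re] at hww
    have key := cross_eq_of_sum_sq_eq (x := fun i => X i t) (y := fun i => -(H i t).im)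
      (w := fun i => -(H' i t).im) (l := L t) (m := m) (hXX t) (by simpa using hxy t)
      (by simpa using hxw) (by simpa using hyy t) (by simpa using hyw) (by linarith) i j
    have e1 : ∀ i, (⟨m * X i t + L t * -(H i t).im, - -(H' i t).im⟩ : ℂ) = H' i t := fun i =>
      Complex.ext (by rw [hH're]; ring) (by simp)
    have e2 : ∀ i, (⟨L t * X i t, - -(H i t).im⟩ : ℂ) = H i t := fun i =>
      Complex.ext (by rw [hHL]) (by simp)
    simpa only [e1, e2] using key

lemma eq_zero_on_sphere_of_im_eq_zero {R : ℝ} (hR : 1 < R) {g : ℂ → ℂ}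
    (hg : DifferentiableOn ℂ g (ball 0 R)) (h0 : g 0 = 0)
    (him : ∀ z : ℂ, ‖z‖ = 1 → (g z).im = 0) : ∀ z : ℂ, ‖z‖ = 1 → g z = 0 := by
  have hsub : closedBall (0:ℂ) 1 ⊆ ball 0 R := closedBall_subset_ball hR
  have hcl : closure (ball (0:ℂ) 1) = closedBall 0 1 := closure_ball _ one_ne_zero
  have hd : DiffContOnCl ℂ (fun z => Complex.exp (-(g z ^ 2))) (ball 0 1) := by
    apply DifferentiableOn.diffContOnCl
    rw [hcl]
    exact (((hg.mono hsub).pow 2).neg).cexp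
  have hre : ∀ z : ℂ, ‖z‖ = 1 → ‖Complex.exp (-(g z ^ 2))‖ = Real.exp (-((g z).re ^ 2)) := by
    intro z hz
    rw [Complex.norm_exp]
    simp [pow_two, him z hz]
  have hmax : IsMaxOn (norm ∘ fun z => Complex.exp (-(g z ^ 2))) (ball (0:ℂ) 1) 0 := by
    intro z hz
    have := Complex.norm_le_of_forall_mem_frontier_norm_le isBounded_ball hd (C := 1)
      (fun w hw => by
        rw [frontier_ball _ one_ne_zero, mem_sphere_zero_iff_norm] at hw
        rw [hre w hw]
        simpa using sq_nonneg _) (subset_closure hz)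
    simpa [h0] using this
  intro z hz
  have h1 := Complex.eqOn_closedBall_of_isMaxOn_norm hd hmax
    (show z ∈ closedBall (0:ℂ) 1 by simp [hz])
  simp only [Function.const] at h1
  have h2 := congrArg norm h1
  rw [hre z hz] at h2
  simp [h0] at h2
  exact Complex.ext h2 (him z hz)

lemma eq_zero_on_ball_of_sphere {R : ℝ} (hR : 1 < R) {g : ℂ → ℂ}
    (hg : DifferentiableOn ℂ g (ball 0 R))
    (h0 : ∀ z : ℂ, ‖z‖ = 1 → g z = 0) : ∀ z ∈ ball (0:ℂ) 1, g z = 0 := by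
  have hsub : closedBall (0:ℂ) 1 ⊆ ball 0 R := closedBall_subset_ball hR
  have hcl : closure (ball (0:ℂ) 1) = closedBall 0 1 := closure_ball _ one_ne_zero
  intro z hz
  exact Complex.eqOn_of_eqOn_frontier (g := 0) isBounded_ball
    (DifferentiableOn.diffContOnCl (by rw [hcl]; exact hg.mono hsub))
    (by exact (differentiable_const (0:ℂ)).diffContOnCl)
    (fun w hw => by
      rw [frontier_ball _ one_ne_zero, mem_sphere_zero_iff_norm] at hw
      exact h0 w hw) hz

/-- A nonconstant holomorphic function of modulus one on the unit circle maps the closed unit disk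
onto itself. -/
lemma closedBall_subset_image {R : ℝ} (hR : 1 < R) {g : ℂ → ℂ}
    (hg : DifferentiableOn ℂ g (ball 0 R)) (h1 : ∀ z : ℂ, ‖z‖ = 1 → ‖g z‖ = 1)
    (hne : ¬ ∃ w, ∀ z ∈ ball (0:ℂ) 1, g z = w) :
    closedBall (0:ℂ) 1 ⊆ g '' closedBall 0 1 := by
  have hsub : closedBall (0:ℂ) 1 ⊆ ball 0 R := closedBall_subset_ball hR
  have hcl : closure (ball (0:ℂ) 1) = closedBall 0 1 := closure_ball _ one_ne_zero
  have hle : ∀ z ∈ ball (0:ℂ) 1, ‖g z‖ ≤ 1 := fun z hz =>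
    Complex.norm_le_of_forall_mem_frontier_norm_le isBounded_ball
      (DifferentiableOn.diffContOnCl (by rw [hcl]; exact hg.mono hsub)) (fun w hw => by
        rw [frontier_ball _ one_ne_zero, mem_sphere_zero_iff_norm] at hw
        exact (h1 w hw).le) (subset_closure hz)
  have hopen : IsOpen (g '' ball 0 1) :=
    (((hg.mono (ball_subset_closedBall.trans hsub)).analyticOnNhd isOpen_ball
      ).is_constant_or_isOpen (convex_ball _ _).isPreconnected).resolve_left hne _
        subset_rfl isOpen_ball
  have hin : g '' ball 0 1 ⊆ ball 0 1 := by
    refine (interior_maximal ?_ hopen).trans (interior_closedBall (0:ℂ) one_ne_zero).subset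
    rintro _ ⟨z, hz, rfl⟩
    simpa using hle z hz
  have hcomp : IsCompact (g '' closedBall 0 1) :=
    (isCompact_closedBall _ _).image_of_continuousOn (hg.continuousOn.mono hsub)
  have hball : ball (0:ℂ) 1 ⊆ g '' ball 0 1 := by
    refine (convex_ball (0:ℂ) 1).isPreconnected.subset_left_of_subset_union hopen
      hcomp.isClosed.isOpen_compl ?_ ?_ ?_
    · exact Set.disjoint_compl_right_iff_subset.2 (Set.image_mono ball_subset_closedBall)
    · intro w hw
      by_cases hw' : w ∈ g '' closedBall 0 1
      · left
        obtain ⟨z, hz, rfl⟩ := hw'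
        refine ⟨z, ?_, rfl⟩
        rcases (mem_closedBall_zero_iff.1 hz).lt_or_eq with h | h
        · simpa using h
        · have := h1 z h
          simp [this] at hw
      · right; exact hw'
    · exact ⟨g 0, hin ⟨0, by simp, rfl⟩, ⟨0, by simp, rfl⟩⟩
  refine hcl.symm.subset.trans ?_
  exact closure_minimal (hball.trans (Set.image_mono ball_subset_closedBall)) hcomp.isClosed

lemma wronskian_eq_zero {ι : Type*} [Fintype ι] {R : ℝ} (hR : 1 < R) {Φ f : ι → ℂ → ℂ}
    (hΦ : ∀ i, ∀ z ∈ ball (0:ℂ) R, HasDerivAt (Φ i) (f i z) z)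
    (hf : ∀ i, DifferentiableOn ℂ (f i) (ball 0 R))
    (hconf : ∀ z ∈ ball (0:ℂ) R, ∑ i, f i z ^ 2 = 0)
    (hsphere : ∀ z : ℂ, ‖z‖ = 1 → ∑ i, (Φ i z).re ^ 2 = 1)
    (hfree : ∀ z : ℂ, ‖z‖ = 1 → ∃ l : ℝ, ∀ i, (z * f i z).re = l * (Φ i z).re) :
    ∀ z ∈ ball (0:ℂ) 1, ∀ i j, deriv (f i) z * f j z - deriv (f j) z * f i z = 0 := by
  have hmem : ∀ z : ℂ, ‖z‖ = 1 → z ∈ ball (0:ℂ) R := fun z hz => by simp [hz, hR]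
  have hf' : ∀ i, DifferentiableOn ℂ (deriv (f i)) (ball 0 R) := fun i =>
    (hf i).deriv isOpen_ball
  have hd : ∀ i, ∀ z ∈ ball (0:ℂ) R, HasDerivAt (f i) (deriv (f i) z) z := fun i z hz =>
    ((hf i).differentiableAt (isOpen_ball.mem_nhds hz)).hasDerivAt
  have hcurve : ∀ z : ℂ, ‖z‖ = 1 →
      (∑ i, (Complex.I * z * (f i z + z * deriv (f i) z)) ^ 2).im = 0 ∧
      (∑ i, (Complex.I * z * (f i z + z * deriv (f i) z)) ^ 2 = 0 → ∀ i j,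
        Complex.I * z * (f i z + z * deriv (f i) z) * (z * f j z) =
        Complex.I * z * (f j z + z * deriv (f j) z) * (z * f i z)) := by
    intro z hz
    set γ : ℝ → ℂ := fun t => Complex.exp (t * Complex.I) * z with hγ
    have hγ1 : ∀ t, ‖γ t‖ = 1 := fun t => by
      simp [hγ, hz, Complex.norm_exp_ofReal_mul_I]
    have hγd : ∀ t, HasDerivAt γ (Complex.I * γ t) t := by
      intro t
      have h1 : HasDerivAt (fun t : ℝ => (t : ℂ) * Complex.I) (1 * Complex.I) t :=
        (Complex.ofRealCLM.hasDerivAt (x := t)).mul_const _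
      refine ((h1.cexp).mul_const z).congr_deriv ?_
      simp only [hγ]; ring
    have hX : ∀ i t, HasDerivAt (fun t => (Φ i (γ t)).re) (-(γ t * f i (γ t)).im) t := by
      intro i t
      have h1 := (hΦ i (γ t) (hmem _ (hγ1 t))).comp_of_eq t (hγd t) rfl
      have h2 := Complex.reCLM.hasFDerivAt.comp_hasDerivAt t h1
      refine h2.congr_deriv ?_
      simp; ring
    have hH : ∀ i t, HasDerivAt (fun t => γ t * f i (γ t))
        (Complex.I * γ t * (f i (γ t) + γ t * deriv (f i) (γ t))) t := by
      intro i t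
      have h1 := (hd i (γ t) (hmem _ (hγ1 t))).comp_of_eq t (hγd t) rfl
      refine ((hγd t).mul h1).congr_deriv ?_
      simp; ring
    have key := curve_hopf hX hH (fun t => hsphere _ (hγ1 t)) (fun t => by
      simp only [mul_pow, ← Finset.mul_sum, hconf _ (hmem _ (hγ1 t)), mul_zero])
      (fun t => hfree _ (hγ1 t)) 0
    have h0 : γ 0 = z := by simp [hγ]
    simpa only [h0] using key
  have hG := eq_zero_on_sphere_of_im_eq_zero hR
    (g := fun z => ∑ i, (Complex.I * z * (f i z + z * deriv (f i) z)) ^ 2)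
    (DifferentiableOn.fun_sum fun i _ =>
      (((differentiableOn_const _).mul differentiableOn_id).mul
        ((hf i).add (differentiableOn_id.mul (hf' i)))).pow 2) (by simp)
    (fun z hz => (hcurve z hz).1)
  intro z hz i j
  refine eq_zero_on_ball_of_sphere hR (g := fun z => deriv (f i) z * f j z - deriv (f j) z * f i z)
    (((hf' i).mul (hf j)).sub ((hf' j).mul (hf i))) (fun w hw => ?_) z hz
  have h1 := (hcurve w hw).2 (hG w hw) i j
  have hw0 : w ≠ 0 := by rintro rfl; simp at hw
  have h2 : Complex.I * w ^ 3 * (deriv (f i) w * f j w - deriv (f j) w * f i w) = 0 := by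
    linear_combination h1
  simpa [hw0] using h2

lemma proportional_of_wronskian {R : ℝ} (hR : 1 < R) {f g : ℂ → ℂ}
    (hf : DifferentiableOn ℂ f (ball 0 R)) (hg : DifferentiableOn ℂ g (ball 0 R))
    (hW : ∀ z ∈ ball (0:ℂ) 1, deriv f z * g z - deriv g z * f z = 0)
    {z₀ : ℂ} (hz₀ : z₀ ∈ ball (0:ℂ) 1) (hg₀ : g z₀ ≠ 0) :
    ∃ c : ℂ, ∀ z ∈ ball (0:ℂ) R, f z = c * g z := by
  have hz₀' : z₀ ∈ ball (0:ℂ) R := ball_subset_ball hR.le hz₀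
  have hev : ∀ᶠ z in nhds z₀, z ∈ ball (0:ℂ) 1 ∧ g z ≠ 0 :=
    Filter.Eventually.and (isOpen_ball.mem_nhds hz₀)
      ((hg.continuousOn.continuousAt (isOpen_ball.mem_nhds hz₀')).eventually_ne hg₀)
  obtain ⟨ε, hε, hball⟩ := Metric.eventually_nhds_iff_ball.1 hev
  have hd : ∀ z ∈ ball z₀ ε, HasDerivAt (fun z => f z / g z) 0 z := by
    intro z hz
    obtain ⟨h1, h2⟩ := hball z hz
    have hn := isOpen_ball.mem_nhds (ball_subset_ball hR.le h1)
    refine ((hf.differentiableAt hn).hasDerivAt.div (hg.differentiableAt hn).hasDerivAt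
      h2).congr_deriv ?_
    rw [show deriv f z * g z - f z * deriv g z = 0 by linear_combination hW z h1, zero_div]
  refine ⟨f z₀ / g z₀, ?_⟩
  refine (hf.analyticOnNhd isOpen_ball).eqOn_of_preconnected_of_eventuallyEq
    ((hg.const_mul _).analyticOnNhd isOpen_ball) (convex_ball _ _).isPreconnected hz₀' ?_
  filter_upwards [ball_mem_nhds z₀ hε] with z hz
  have := isOpen_ball.is_const_of_deriv_eq_zero (convex_ball z₀ ε).isPreconnected
    (fun z hz => (hd z hz).differentiableAt.differentiableWithinAt)
    (fun z hz => (hd z hz).deriv) hz (mem_ball_self hε)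
  rw [← this, div_mul_cancel₀ _ (hball z hz).2]

/-- The real linear map `w ↦ Re (c w)`. -/
noncomputable def reSmul {ι : Type*} (c : ι → ℂ) : ℂ →ₗ[ℝ] (ι → ℝ) where
  toFun w i := (c i * w).re
  map_add' x y := by ext i; simp; ring
  map_smul' r x := by ext i; simp; ring

lemma sum_re_mul_sq {ι : Type*} [Fintype ι] {c : ι → ℂ} (hc : ∑ i, c i ^ 2 = 0) (w : ℂ) :
    ∑ i, (c i * w).re ^ 2 = (∑ i, ‖c i‖ ^ 2) / 2 * ‖w‖ ^ 2 := by
  have hre := congrArg Complex.re hc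
  have him := congrArg Complex.im hc
  simp only [Complex.re_sum, Complex.im_sum, pow_two, Complex.mul_re, Complex.mul_im,
    Complex.zero_re, Complex.zero_im, Finset.sum_sub_distrib, Finset.sum_add_distrib] at hre him
  simp only [← Complex.normSq_eq_norm_sq, Complex.normSq_apply, Complex.mul_re,
    Finset.sum_add_distrib]
  have : ∀ i, ((c i).re * w.re - (c i).im * w.im) ^ 2 = w.re ^ 2 * ((c i).re * (c i).re)
    + w.im ^ 2 * ((c i).im * (c i).im) - w.re * w.im * ((c i).re * (c i).im)
     - w.re * w.im * ((c i).im * (c i).re) := fun i => by ring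
  simp only [this, Finset.sum_add_distrib, Finset.sum_sub_distrib, ← Finset.mul_sum]
  linear_combination (w.re ^ 2 - w.im ^ 2) / 2 * hre - w.re * w.im * him

lemma exists_orthogonal_decomp {ι : Type*} [Fintype ι] {c : ι → ℂ} (hc : ∑ i, c i ^ 2 = 0)
    (hc0 : ∑ i, ‖c i‖ ^ 2 ≠ 0) (e : ι → ℝ) :
    ∃ (s : ℂ) (e' : ι → ℝ), (∀ i, e i = (c i * s).re + e' i) ∧ ∑ i, (e' i : ℂ) * c i = 0 := by
  refine ⟨2 / (∑ i, ‖c i‖ ^ 2 : ℝ) * ∑ i, (e i : ℂ) * (starRingEnd ℂ) (c i),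
    fun i => e i - (c i * (2 / (∑ i, ‖c i‖ ^ 2 : ℝ) *
      ∑ i, (e i : ℂ) * (starRingEnd ℂ) (c i))).re, fun i => by ring, ?_⟩
  set N : ℝ := ∑ i, ‖c i‖ ^ 2 with hN
  set S : ℂ := ∑ i, (e i : ℂ) * (starRingEnd ℂ) (c i) with hS
  have hN' : (N : ℂ) = ∑ i, c i * (starRingEnd ℂ) (c i) := by
    rw [hN]; push_cast
    exact Finset.sum_congr rfl fun i _ => (Complex.mul_conj' _).symm
  have hS' : (starRingEnd ℂ) S = ∑ i, (e i : ℂ) * c i := by simp [hS]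
  have hN0 : (N : ℂ) ≠ 0 := by exact_mod_cast hc0
  have h1 : ∀ i, ((e i - (c i * (2 / N * S)).re : ℝ) : ℂ) * c i =
      e i * c i - (S / N) * c i ^ 2 - (starRingEnd ℂ S / N) * (c i * (starRingEnd ℂ) (c i)) := by
    intro i
    rw [Complex.ofReal_sub, Complex.re_eq_add_conj]
    simp [map_ofNat]
    ring
  simp only [h1, Finset.sum_sub_distrib, ← Finset.mul_sum, hc, ← hN', ← hS']
  field_simp
  ring

lemma image_of_eq_re {ι : Type*} [Fintype ι] {R : ℝ} (hR : 1 < R) {c : ι → ℂ} {G : ℂ → ℂ}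
    {u : ℂ → ι → ℝ} (hc : ∑ i, c i ^ 2 = 0) (hc0 : 0 < ∑ i, ‖c i‖ ^ 2)
    (hG : DifferentiableOn ℂ G (ball 0 R)) (hne : ¬ ∃ w, ∀ z ∈ ball (0:ℂ) 1, G z = w)
    (hu : ∀ z ∈ ball (0:ℂ) R, ∀ i, u z i = (c i * G z).re)
    (hball : ∀ z ∈ closedBall (0 : ℂ) 1, ∑ i, (u z i) ^ 2 ≤ 1)
    (hsphere : ∀ z : ℂ, ‖z‖ = 1 → ∑ i, (u z i) ^ 2 = 1) :
    ∃ P : Submodule ℝ (ι → ℝ), Module.finrank ℝ P = 2 ∧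
      u '' closedBall (0 : ℂ) 1 = {x : ι → ℝ | x ∈ P ∧ ∑ i, (x i) ^ 2 ≤ 1} := by
  have hsub : closedBall (0:ℂ) 1 ⊆ ball 0 R := closedBall_subset_ball hR
  obtain ⟨ρ, hρ, hρ2⟩ : ∃ ρ : ℝ, 0 < ρ ∧ ρ ^ 2 = (∑ i, ‖c i‖ ^ 2) / 2 :=
    ⟨_, Real.sqrt_pos.2 (half_pos hc0), Real.sq_sqrt (half_pos hc0).le⟩
  have hnorm : ∀ w : ℂ, ∑ i, (reSmul c w i) ^ 2 = ‖(ρ : ℂ) * w‖ ^ 2 := by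
    intro w
    rw [norm_mul, mul_pow, Complex.norm_real, Real.norm_of_nonneg hρ.le, hρ2]
    exact sum_re_mul_sq hc w
  have huG : ∀ z ∈ closedBall (0:ℂ) 1, u z = reSmul c (G z) := fun z hz =>
    funext fun i => hu z (hsub hz) i
  have hinj : Function.Injective (reSmul c) := by
    rw [← LinearMap.ker_eq_bot, LinearMap.ker_eq_bot']
    intro w hw
    have := (hnorm w).symm
    simpa [hw, hρ.ne'] using this
  refine ⟨LinearMap.range (reSmul c), ?_, ?_⟩
  · rw [LinearMap.finrank_range_of_inj hinj, Complex.finrank_real_complex]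
  · ext x
    constructor
    · rintro ⟨z, hz, rfl⟩
      exact ⟨⟨G z, (huG z hz).symm⟩, hball z hz⟩
    · rintro ⟨⟨w, rfl⟩, hw⟩
      rw [hnorm, sq_le_one_iff₀ (norm_nonneg _)] at hw
      obtain ⟨z, hz, hzw⟩ := closedBall_subset_image hR (g := fun z => (ρ : ℂ) * G z)
        (hG.const_mul _) (fun z hz => by
          have h1 := hsphere z hz
          rw [huG z (by simp [hz]), hnorm] at h1
          exact (pow_eq_one_iff_of_nonneg (norm_nonneg _) two_ne_zero).1 h1)
        (by
          rintro ⟨w, hw⟩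
          exact hne ⟨w / ρ, fun z hz => by
            rw [← hw z hz, mul_div_cancel_left₀ _ (by exact_mod_cast hρ.ne')]⟩)
        (mem_closedBall_zero_iff.2 hw)
      have : G z = w := mul_left_cancel₀ (by exact_mod_cast hρ.ne') hzw
      exact ⟨z, hz, by rw [huG z hz, this]⟩

/-- The uniqueness theorem for a map given as the real part of a holomorphic vector `Φ` with
isotropic derivative `f`. -/
lemma image_of_holomorphic {ι : Type*} [Fintype ι] {R : ℝ} (hR : 1 < R) {Φ f : ι → ℂ → ℂ}
    {u : ℂ → ι → ℝ} (hu : ∀ z ∈ ball (0:ℂ) R, ∀ i, u z i = (Φ i z).re)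
    (hΦ : ∀ i, ∀ z ∈ ball (0:ℂ) R, HasDerivAt (Φ i) (f i z) z)
    (hf : ∀ i, DifferentiableOn ℂ (f i) (ball 0 R))
    (hconf : ∀ z ∈ ball (0:ℂ) R, ∑ i, f i z ^ 2 = 0)
    (hne : ∃ z ∈ ball (0 : ℂ) 1, ∃ i, f i z ≠ 0)
    (hball : ∀ z ∈ closedBall (0 : ℂ) 1, ∑ i, (u z i) ^ 2 ≤ 1)
    (hsphere : ∀ z : ℂ, ‖z‖ = 1 → ∑ i, (u z i) ^ 2 = 1)
    (hfree : ∀ z : ℂ, ‖z‖ = 1 → ∃ l : ℝ, ∀ i, (z * f i z).re = l * u z i) :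
    ∃ P : Submodule ℝ (ι → ℝ), Module.finrank ℝ P = 2 ∧
      u '' closedBall (0 : ℂ) 1 = {x : ι → ℝ | x ∈ P ∧ ∑ i, (x i) ^ 2 ≤ 1} := by
  have hmem : ∀ z : ℂ, ‖z‖ = 1 → z ∈ ball (0:ℂ) R := fun z hz => by simp [hz, hR]
  obtain ⟨z₀, hz₀, j, hj⟩ := hne
  have hz₀R : z₀ ∈ ball (0:ℂ) R := ball_subset_ball hR.le hz₀
  have hW := wronskian_eq_zero hR hΦ hf hconf
    (fun z hz => by simpa only [hu z (hmem z hz)] using hsphere z hz)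
    (fun z hz => by simpa only [hu z (hmem z hz)] using hfree z hz)
  choose c hcf using fun i =>
    proportional_of_wronskian hR (hf i) (hf j) (fun z hz => hW z hz i j) hz₀ hj
  have hc : ∑ i, c i ^ 2 = 0 := by
    have h1 := hconf z₀ hz₀R
    rw [Finset.sum_congr rfl fun i _ => by rw [hcf i z₀ hz₀R, mul_pow], ← Finset.sum_mul] at h1
    exact (mul_eq_zero.1 h1).resolve_right (pow_ne_zero 2 hj)
  have hcj : c j = 1 := by
    have h1 := hcf j z₀ hz₀R
    exact (mul_right_cancel₀ hj (by rw [one_mul]; exact h1)).symm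
  have hc0 : 0 < ∑ i, ‖c i‖ ^ 2 :=
    Finset.sum_pos' (fun i _ => sq_nonneg _) ⟨j, Finset.mem_univ _, by rw [hcj]; norm_num⟩
  have hΦc : ∀ i, ∃ d : ℂ, ∀ z ∈ ball (0:ℂ) R, Φ i z = c i * Φ j z + d := by
    intro i
    have hd : ∀ z ∈ ball (0:ℂ) R, HasDerivAt (fun z => Φ i z - c i * Φ j z) 0 z := fun z hz =>
      ((hΦ i z hz).sub ((hΦ j z hz).const_mul (c i))).congr_deriv (by rw [hcf i z hz, sub_self])
    obtain ⟨d, hd⟩ := isOpen_ball.exists_is_const_of_deriv_eq_zero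
      (convex_ball (0:ℂ) R).isPreconnected
      (fun z hz => (hd z hz).differentiableAt.differentiableWithinAt) (fun z hz => (hd z hz).deriv)
    exact ⟨d, fun z hz => by rw [← hd z hz]; ring⟩
  choose d hd using hΦc
  obtain ⟨s, e, hde, he⟩ := exists_orthogonal_decomp hc hc0.ne' (fun i => (d i).re)
  have hu' : ∀ z ∈ ball (0:ℂ) R, ∀ i, u z i = (c i * (Φ j z + s)).re + e i := fun z hz i => by
    rw [hu z hz, hd i z hz, Complex.add_re, hde, mul_add, Complex.add_re, add_assoc]
  have horth : ∀ w : ℂ, ∑ i, e i * (c i * w).re = 0 := by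
    intro w
    have h1 := congrArg Complex.re (congrArg (· * w) he)
    simp only [Finset.sum_mul, Complex.re_sum, zero_mul, Complex.zero_re] at h1
    rw [← h1]
    exact Finset.sum_congr rfl fun i _ => by rw [mul_assoc, Complex.re_ofReal_mul]
  have he0 : ∀ i, e i = 0 := by
    by_contra hcon
    have hesum : ∑ i, e i ^ 2 ≠ 0 := fun h => hcon fun i =>
      pow_eq_zero_iff two_ne_zero |>.1 <| (Finset.sum_eq_zero_iff_of_nonneg
        (fun i _ => sq_nonneg (e i))).1 h i (Finset.mem_univ i)
    refine hj (eq_zero_on_ball_of_sphere hR (hf j) (fun z hz => ?_) z₀ hz₀)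
    obtain ⟨l, hl⟩ := hfree z hz
    have hl' : ∀ i, (c i * (z * f j z)).re = l * (c i * (Φ j z + s)).re + l * e i := fun i => by
      rw [← mul_add, ← hu' z (hmem z hz), ← hl, hcf i z (hmem z hz)]; ring_nf
    have h1 := horth (z * f j z)
    have h2 : ∀ i, e i * (c i * (z * f j z)).re =
        l * (e i * (c i * (Φ j z + s)).re) + l * e i ^ 2 := fun i => by rw [hl']; ring
    simp only [h2, Finset.sum_add_distrib, ← Finset.mul_sum, horth, mul_zero, zero_add] at h1
    have hl0 : l = 0 := (mul_eq_zero.1 h1).resolve_right hesum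
    have h3 := sum_re_mul_sq hc (z * f j z)
    simp only [hl', hl0, zero_mul, add_zero] at h3
    have hz0 : z ≠ 0 := by rintro rfl; simp at hz
    simpa [hc0.ne', hz0] using h3
  refine image_of_eq_re hR (c := c) (G := fun z => Φ j z + s) hc hc0 ?_ ?_ ?_ hball hsphere
  · exact fun z hz => ((hΦ j z hz).add_const s).differentiableAt.differentiableWithinAt
  · rintro ⟨w, hw⟩
    have h1 := (hΦ j z₀ hz₀R).add_const s
    have h2 : (fun z => Φ j z + s) =ᶠ[nhds z₀] fun _ => w :=
      Filter.eventually_of_mem (isOpen_ball.mem_nhds hz₀) hw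
    exact hj (h1.unique ((hasDerivAt_const z₀ w).congr_of_eventuallyEq h2))
  · exact fun z hz i => by rw [hu' z hz, he0, add_zero]

lemma fderiv_cplx {n : ℕ} {u : ℂ → (Fin n → ℝ)} {z : ℂ} (hu : DifferentiableAt ℝ u z) (v : ℂ)
    (i : Fin n) : fderiv ℝ (cplx u) z v i = (fderiv ℝ u z v i : ℂ) := by
  have h : HasFDerivAt (cplx u) (ContinuousLinearMap.pi fun i =>
      Complex.ofRealCLM.comp ((ContinuousLinearMap.proj i).comp (fderiv ℝ u z))) z :=
    hasFDerivAt_pi.2 fun i => Complex.ofRealCLM.hasFDerivAt.comp z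
      (hasFDerivAt_pi'.1 hu.hasFDerivAt i)
  rw [h.fderiv]
  simp

lemma differentiableAt_wdz_cplx {n : ℕ} {U : Set ℂ} (hU : IsOpen U) {u : ℂ → (Fin n → ℝ)}
    (hu : ContDiffOn ℝ (⊤ : ℕ∞) u U) {z : ℂ} (hz : z ∈ U) :
    DifferentiableAt ℝ (wdz (cplx u)) z := by
  have hc : ContDiffOn ℝ (⊤ : ℕ∞) (cplx u) U := contDiffOn_pi.2 fun i =>
    Complex.ofRealCLM.contDiff.comp_contDiffOn (contDiffOn_pi.1 hu i)
  have hd : DifferentiableAt ℝ (fderiv ℝ (cplx u)) z :=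
    ((hc.fderiv_of_isOpen (m := 1) hU (by norm_cast)).differentiableOn (by simp)
      ).differentiableAt (hU.mem_nhds hz)
  unfold wdz
  exact ((hd.clm_apply (differentiableAt_const _)).sub
    ((hd.clm_apply (differentiableAt_const _)).const_smul Complex.I)).const_smul (1 / 2 : ℂ)

lemma differentiableAt_complex_of_wdzbar_eq_zero {E : Type*} [NormedAddCommGroup E]
    [NormedSpace ℂ E] {g : ℂ → E} {z : ℂ} (hg : DifferentiableAt ℝ g z) (h : wdzbar g z = 0) :
    DifferentiableAt ℂ g z := by
  refine differentiableAt_complex_iff_differentiableAt_real.2 ⟨hg, ?_⟩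
  have h1 := (smul_eq_zero.1 h).resolve_left (by norm_num)
  have h2 := congrArg (Complex.I • ·) h1
  simp only [smul_add, smul_smul, Complex.I_mul_I, neg_smul, one_smul, smul_zero] at h2
  exact (add_neg_eq_zero.1 h2).symm

lemma fderiv_apply_eq_re {n : ℕ} {u : ℂ → (Fin n → ℝ)} (z v : ℂ) (i : Fin n) :
    fderiv ℝ u z v i =
      (v * ((fderiv ℝ u z 1 i : ℂ) - Complex.I * (fderiv ℝ u z Complex.I i : ℂ))).re := by
  have hv : v = v.re • (1 : ℂ) + v.im • Complex.I := by simp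
  conv_lhs => rw [hv, map_add, map_smul, map_smul]
  simp

/-- Fraser–Schoen / Nitsche uniqueness theorem: a proper branched minimal immersion of
the disk into the Euclidean unit ball `Bⁿ` meeting `∂Bⁿ` orthogonally has image equal to
an equatorial totally geodesic disk, i.e. the intersection of `Bⁿ` with a 2-plane
through the origin. -/
theorem free_boundary_minimal_disk_is_equatorial (n : ℕ) (U : Set ℂ) (hU : IsOpen U)
    (hDU : closedBall (0 : ℂ) 1 ⊆ U)
    (u : ℂ → (Fin n → ℝ)) (hu : ContDiffOn ℝ (⊤ : ℕ∞) u U)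
    (hharm : ∀ z ∈ U, wdzbar (wdz (cplx u)) z = 0)
    (hconf : ∀ z ∈ U, (∑ i, wdz (cplx u) z i * wdz (cplx u) z i) = 0)
    (hnotconst : ∃ z ∈ ball (0 : ℂ) 1, wdz (cplx u) z ≠ 0)
    (hball : ∀ z ∈ closedBall (0 : ℂ) 1, ∑ i, (u z i) ^ 2 ≤ 1)
    (hproper : ∀ z : ℂ, ‖z‖ = 1 → ∑ i, (u z i) ^ 2 = 1)
    (hfree : ∀ z : ℂ, ‖z‖ = 1 → ∃ lam : ℝ, fderiv ℝ u z z = lam • u z) :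
    ∃ P : Submodule ℝ (Fin n → ℝ), Module.finrank ℝ P = 2 ∧
      u '' closedBall (0 : ℂ) 1 = {x : Fin n → ℝ | x ∈ P ∧ ∑ i, (x i) ^ 2 ≤ 1} := by
  have huat : ∀ z ∈ U, DifferentiableAt ℝ u z := fun z hz =>
    (hu.differentiableOn (by simp)).differentiableAt (hU.mem_nhds hz)
  have hwdz : ∀ z ∈ U, ∀ i, 2 * wdz (cplx u) z i =
      (fderiv ℝ u z 1 i : ℂ) - Complex.I * (fderiv ℝ u z Complex.I i : ℂ) := fun z hz i => by
    simp [wdz, fderiv_cplx (huat z hz)]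
  obtain ⟨R, hR, hRU⟩ : ∃ R : ℝ, 1 < R ∧ ball (0:ℂ) R ⊆ U := by
    obtain ⟨δ, hδ, h⟩ := (isCompact_closedBall (0:ℂ) 1).exists_thickening_subset_open hU hDU
    rw [thickening_closedBall hδ zero_le_one] at h
    exact ⟨δ + 1, by linarith, h⟩
  have hF : ∀ z ∈ U, DifferentiableAt ℂ (wdz (cplx u)) z := fun z hz =>
    differentiableAt_complex_of_wdzbar_eq_zero (differentiableAt_wdz_cplx hU hu hz) (hharm z hz)
  have hf : ∀ i, DifferentiableOn ℂ (fun z => 2 * wdz (cplx u) z i) (ball 0 R) := fun i z hz =>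
    ((differentiableAt_pi.1 (hF z (hRU hz)) i).const_mul 2).differentiableWithinAt
  choose Φ hΦ0 hΦ using fun i => (hf i).isExactOn_ball.with_val_at 0 (u 0 i : ℂ)
  refine image_of_holomorphic hR (Φ := Φ) (f := fun i z => 2 * wdz (cplx u) z i)
    ?_ hΦ hf ?_ ?_ hball hproper ?_
  · intro z hz i
    have h1 : ∀ z ∈ ball (0:ℂ) R, HasFDerivAt (fun z => u z i)
        ((ContinuousLinearMap.proj i).comp (fderiv ℝ u z)) z := fun z hz =>
      hasFDerivAt_pi'.1 (huat z (hRU hz)).hasFDerivAt i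
    have h2 : ∀ z ∈ ball (0:ℂ) R, HasFDerivAt (fun z => (Φ i z).re) _ z := fun z hz =>
      Complex.reCLM.hasFDerivAt.comp z ((hΦ i z hz).hasFDerivAt.restrictScalars ℝ)
    refine isOpen_ball.eqOn_of_fderiv_eq (𝕜 := ℝ) (convex_ball (0:ℂ) R).isPreconnected
      (fun z hz => (h1 z hz).differentiableAt.differentiableWithinAt)
      (fun z hz => (h2 z hz).differentiableAt.differentiableWithinAt) (fun z hz => ?_)
      (mem_ball_self (by linarith)) (by simp [hΦ0]) hz
    rw [(h1 z hz).fderiv, (h2 z hz).fderiv]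
    ext v
    have h3 := fderiv_apply_eq_re (u := u) z v i
    rw [← hwdz z (hRU hz)] at h3
    simpa [mul_comm] using h3
  · intro z hz
    have h1 := hconf z (hRU hz)
    simp only [mul_pow, ← Finset.mul_sum, pow_two (wdz (cplx u) z _), h1, mul_zero]
  · obtain ⟨z, hz, h⟩ := hnotconst
    obtain ⟨i, hi⟩ := Function.ne_iff.1 h
    exact ⟨z, hz, i, mul_ne_zero two_ne_zero hi⟩
  · intro z hz
    obtain ⟨l, hl⟩ := hfree z hz
    refine ⟨l, fun i => ?_⟩
    simp only [hwdz z (hDU (by simp [hz])), ← fderiv_apply_eq_re (u := u) z z i, hl,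
      Pi.smul_apply, smul_eq_mul]
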